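/- arXiv:1107.0248 — 2 statements merged into one kernel-verified Lean document; each statement's English description precedes it below -/
import Mathlib

section
/- Let k be an algebraically closed field and n ≥ 1. For an invertible lower triangular n×n matrix A over k and for each i = 1, …, n, let A_i be the i×i matrix obtained from A by erasing the last n − i rows and columns, let C_i be the i×i matrix with entries 1 on and above the diagonal and 0 below, and let D_i = A_i·C_i (equivalently, D_i is the principal i×i submatrix of A·C_n). Then the map Π sending A to the n-tuple (χ_1, …, χ_n), where χ_i is the characteristic polynomial of D_i, is a bijection from the group B of invertible lower triangular n×n matrices over k onto the set of n-tuples (p_1, …, p_n) of polynomials in k[t] such that each p_i is monic of degree i with nonzero constant term. Equivalently, recording for each i the i coefficients of the characteristic polynomial of D_i (whose leading nontrivial coefficient, the determinant, is nonzero), Π is an isomorphism from B onto k^{n(n−1)/2} × (k^*)^n. -/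
/-- The upper triangular all-ones matrix `C`. -/
def Cmat (k : Type*) [Field k] (n : ℕ) : Matrix (Fin n) (Fin n) k :=
  Matrix.of fun i j => if i ≤ j then 1 else 0

open Polynomial in
/-- Lower rows of `t - D`, with an arbitrary last row given by partial sums of `r`. -/
noncomputable def Gmat {k : Type*} [Field k] (a : ℕ → ℕ → k) (m : ℕ) (r : ℕ → k[X]) :
    Matrix (Fin (m + 1)) (Fin (m + 1)) k[X] :=
  Matrix.of fun i j =>
    if i.val < m then (if i = j then X else 0) - C (∑ l ∈ Finset.range (j.val + 1), a i.val l)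
    else ∑ l ∈ Finset.range (j.val + 1), r l

/-- The principal block of `A * C`. -/
def Mmat {k : Type*} [Field k] (a : ℕ → ℕ → k) (m : ℕ) : Matrix (Fin m) (Fin m) k :=
  Matrix.of fun i j => ∑ l ∈ Finset.range (j.val + 1), a i.val l

open Polynomial in
lemma Gmat_step {k : Type*} [Field k] (a : ℕ → ℕ → k) (ha : ∀ i j, i < j → a i j = 0) (m : ℕ)
    (r : ℕ → k[X]) :
    (Gmat a (m + 1) r).det = r (m + 1) * (Mmat a (m + 1)).charpoly + X * (Gmat a m r).det := by
  have hne : Fin.last (m + 1) ≠ (Fin.last m).castSucc := by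
    intro h; have := congrArg Fin.val h; simp at this
  rw [← Matrix.det_updateCol_add_smul_self (Gmat a (m + 1) r) hne (-1),
    Matrix.det_succ_column _ (Fin.last (m + 1)), Fin.sum_univ_castSucc, Fin.sum_univ_castSucc]
  rw [Finset.sum_eq_zero]
  · have h1 : ((Matrix.updateCol (Gmat a (m + 1) r) (Fin.last (m + 1))
        (fun i => Gmat a (m + 1) r i (Fin.last (m + 1)) +
          (-1 : k[X]) • Gmat a (m + 1) r i (Fin.last m).castSucc)).submatrix
          (Fin.last (m + 1)).succAbove (Fin.last (m + 1)).succAbove)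
        = (Mmat a (m + 1)).charmatrix := by
      ext1 i j
      simp [Matrix.charmatrix_apply, Matrix.diagonal_apply, Gmat, Mmat, Matrix.updateCol_apply,
        (Fin.castSucc_lt_last j).ne]
      intro h; omega
    have h2 : ((Matrix.updateCol (Gmat a (m + 1) r) (Fin.last (m + 1))
        (fun i => Gmat a (m + 1) r i (Fin.last (m + 1)) +
          (-1 : k[X]) • Gmat a (m + 1) r i (Fin.last m).castSucc)).submatrix
          ((Fin.last m).castSucc).succAbove (Fin.last (m + 1)).succAbove)
        = Gmat a m r := by
      ext1 i j
      refine Fin.lastCases ?_ (fun i => ?_) i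
      · simp [Gmat, Matrix.updateCol_apply, (Fin.castSucc_lt_last j).ne]
      · have : (Fin.last m).castSucc.succAbove i.castSucc = i.castSucc.castSucc := by
          rw [Fin.succAbove_of_castSucc_lt]
          exact Fin.castSucc_lt_castSucc_iff.2 (Fin.castSucc_lt_last i)
        have hi : i.val < m + 1 := by omega
        simp [Gmat, Matrix.updateCol_apply, (Fin.castSucc_lt_last j).ne, this, hi]
    rw [h1, h2, Matrix.charpoly]
    have e1 : (-1 : k[X]) ^ ((m + 1) + (m + 1)) = 1 := Even.neg_one_pow ⟨_, rfl⟩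
    have e2 : (-1 : k[X]) ^ (m + (m + 1)) = -1 := Odd.neg_one_pow ⟨m, by ring⟩
    simp [Gmat, Matrix.updateCol_apply, e1, e2, Finset.sum_range_succ _ (m + 1), hne.symm,
      ha m (m + 1) (by omega)]
    ring
  · intro i _
    have hi : i.val < m + 1 := by omega
    have n1 : i.castSucc.castSucc ≠ Fin.last (m + 1) := (Fin.castSucc_lt_last _).ne
    have n2 : i.castSucc ≠ Fin.last m := (Fin.castSucc_lt_last _).ne
    simp [Gmat, Matrix.updateCol_apply, Finset.sum_range_succ _ (m + 1), n1, n2, hi,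
      ha i (m + 1) (by omega)]

open Polynomial in
lemma Gmat_det {k : Type*} [Field k] (a : ℕ → ℕ → k) (ha : ∀ i j, i < j → a i j = 0) (m : ℕ)
    (r : ℕ → k[X]) :
    (Gmat a m r).det =
      ∑ j ∈ Finset.range (m + 1), r j * X ^ (m - j) * (Mmat a j).charpoly := by
  induction m with
  | zero => simp [Gmat, Matrix.charpoly]
  | succ m ih =>
    rw [Gmat_step a ha, ih, Finset.sum_range_succ _ (m + 1), Finset.mul_sum, add_comm]
    congr 1
    · refine Finset.sum_congr rfl fun j hj => ?_
      have : j ≤ m := by simpa [Nat.lt_succ_iff] using hj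
      rw [Nat.succ_sub this, pow_succ]; ring
    · simp

open Polynomial in
lemma Mmat_rec {k : Type*} [Field k] (a : ℕ → ℕ → k) (ha : ∀ i j, i < j → a i j = 0) (m : ℕ) :
    (Mmat a (m + 1)).charpoly = X * (Mmat a m).charpoly -
      ∑ j ∈ Finset.range (m + 1), C (a m j) * X ^ (m - j) * (Mmat a j).charpoly := by
  have h : (Mmat a (m + 1)).charmatrix = Gmat a m (fun j => (if j = m then X else 0) - C (a m j)) := by
    ext1 i j
    simp only [Matrix.charmatrix_apply, Matrix.diagonal_apply, Gmat, Mmat, Matrix.of_apply]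
    split_ifs with h1 h2 h2
    · rfl
    · have hi : i.val = m := by omega
      subst h1
      simp [Finset.sum_sub_distrib, hi]
    · rfl
    · have hi : i.val = m := by omega
      have : ¬ m < j.val + 1 := by
        intro h; apply h1; ext; omega
      have h3 : ¬ m ≤ j.val := by omega
      simp [Finset.sum_sub_distrib, hi, h3]
  rw [Matrix.charpoly, h, Gmat_det a ha]
  simp only [sub_mul, Finset.sum_sub_distrib]
  congr 1
  rw [Finset.sum_range_succ, Finset.sum_eq_zero]
  · simp
  · intro j hj
    have : j ≠ m := by have := Finset.mem_range.1 hj; omega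
    simp [this]

open Polynomial in
lemma comb_step {k : Type*} [Field k] (f : ℕ → k[X]) (c : ℕ → k) (m : ℕ) :
    ∑ j ∈ Finset.range (m + 1 + 1), C (c j) * X ^ (m + 1 - j) * f j =
      X * (∑ j ∈ Finset.range (m + 1), C (c j) * X ^ (m - j) * f j) + C (c (m + 1)) * f (m + 1) := by
  rw [Finset.sum_range_succ _ (m + 1), Finset.mul_sum]
  congr 1
  · refine Finset.sum_congr rfl fun j hj => ?_
    have : j ≤ m := by simpa [Nat.lt_succ_iff] using hj
    rw [Nat.succ_sub this, pow_succ]; ring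
  · simp

open Polynomial in
lemma comb_coeff {k : Type*} [Field k] (f : ℕ → k[X]) (c : ℕ → k) (m : ℕ) :
    (∑ j ∈ Finset.range (m + 1), C (c j) * X ^ (m - j) * f j).coeff 0 = c m * (f m).coeff 0 := by
  cases m with
  | zero => simp
  | succ m => rw [comb_step]; simp

open Polynomial in
lemma comb_exists {k : Type*} [Field k] (f : ℕ → k[X]) (m : ℕ)
    (h0 : ∀ j ≤ m, (f j).coeff 0 ≠ 0) (hd : ∀ j ≤ m, (f j).natDegree ≤ j) (q : k[X])
    (hq : q.natDegree ≤ m) :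
    ∃ c : ℕ → k, q = ∑ j ∈ Finset.range (m + 1), C (c j) * X ^ (m - j) * f j := by
  induction m generalizing q with
  | zero =>
    refine ⟨fun _ => q.coeff 0 / (f 0).coeff 0, ?_⟩
    have h1 := eq_C_of_natDegree_le_zero hq
    have h2 := eq_C_of_natDegree_le_zero (hd 0 le_rfl)
    have h3 := h0 0 le_rfl
    rw [Finset.sum_range_one, h2, h1]
    simp only [coeff_C_zero, Nat.sub_self, pow_zero, mul_one, ← C_mul]
    rw [div_mul_cancel₀ _ h3]
  | succ m ih =>
    have h3 := h0 (m + 1) le_rfl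
    set s := q.coeff 0 / (f (m + 1)).coeff 0 with hs
    set u := q - C s * f (m + 1) with hu
    have hu0 : u.coeff 0 = 0 := by
      simp [hu, hs, div_mul_cancel₀ _ h3]
    have hud : u.natDegree ≤ m + 1 := by
      refine (natDegree_sub_le _ _).trans (max_le hq ?_)
      exact (natDegree_C_mul_le _ _).trans (hd _ le_rfl)
    have hdiv : X * u.divX = u := by
      have := X_mul_divX_add u
      rw [hu0] at this
      simpa using this
    obtain ⟨c, hc⟩ := ih (fun j hj => h0 j (by omega)) (fun j hj => hd j (by omega)) u.divX
      (by rw [natDegree_divX_eq_natDegree_tsub_one]; omega)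
    refine ⟨fun j => if j = m + 1 then s else c j, ?_⟩
    rw [comb_step]
    have : ∑ j ∈ Finset.range (m + 1), C (if j = m + 1 then s else c j) * X ^ (m - j) * f j
        = u.divX := by
      rw [hc]
      refine Finset.sum_congr rfl fun j hj => ?_
      have : j ≠ m + 1 := by have := Finset.mem_range.1 hj; omega
      simp [this]
    rw [this, hdiv]
    simp [hu]

open Polynomial in
lemma comb_unique {k : Type*} [Field k] (f : ℕ → k[X]) (m : ℕ)
    (h0 : ∀ j ≤ m, (f j).coeff 0 ≠ 0) (c d : ℕ → k)
    (h : ∑ j ∈ Finset.range (m + 1), C (c j) * X ^ (m - j) * f j =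
      ∑ j ∈ Finset.range (m + 1), C (d j) * X ^ (m - j) * f j) :
    ∀ j ≤ m, c j = d j := by
  induction m with
  | zero =>
    intro j hj
    obtain rfl : j = 0 := by omega
    have := congrArg (fun p => coeff p 0) h
    simp only [comb_coeff] at this
    exact mul_right_cancel₀ (h0 0 le_rfl) this
  | succ m ih =>
    have h1 := congrArg (fun p => coeff p 0) h
    simp only [comb_coeff] at h1
    have h2 := mul_right_cancel₀ (h0 _ le_rfl) h1
    rw [comb_step, comb_step, h2] at h
    have h3 := mul_left_cancel₀ X_ne_zero (add_right_cancel h)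
    intro j hj
    rcases Nat.lt_or_ge m j with h4 | h4
    · obtain rfl : j = m + 1 := by omega
      exact h2
    · exact ih (fun j hj => h0 j (by omega)) h3 j h4

/-- Extension of a matrix by zero. -/
def extM {k : Type*} [Field k] {n : ℕ} (A : Matrix (Fin n) (Fin n) k) (i j : ℕ) : k :=
  if h : i < n ∧ j < n then A ⟨i, h.1⟩ ⟨j, h.2⟩ else 0

lemma extM_lower {k : Type*} [Field k] {n : ℕ} (A : Matrix (Fin n) (Fin n) k)
    (hA : ∀ i j : Fin n, i < j → A i j = 0) (i j : ℕ) (h : i < j) : extM A i j = 0 := by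
  unfold extM
  split_ifs with h1
  · exact hA _ _ h
  · rfl

lemma sub_eq_Mmat {k : Type*} [Field k] {n : ℕ} (A : Matrix (Fin n) (Fin n) k) (m : Fin n) :
    (A * Cmat k n).submatrix (Fin.castLE m.isLt) (Fin.castLE m.isLt) =
      Mmat (extM A) (m.val + 1) := by
  ext i j
  have hi : i.val < n := by omega
  have hj : j.val < n := by omega
  simp only [Matrix.submatrix_apply, Matrix.mul_apply, Cmat, Mmat, Matrix.of_apply]
  have : ∀ l : Fin n, A (Fin.castLE m.isLt i) l * (if l ≤ Fin.castLE m.isLt j then (1 : k) else 0)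
      = (fun l : ℕ => if l < j.val + 1 then extM A i.val l else 0) l.val := by
    intro l
    simp [extM, Fin.le_def, Nat.lt_succ_iff, hi, Fin.castLE]
  rw [Finset.sum_congr rfl (fun l _ => this l),
    Fin.sum_univ_eq_sum_range (fun l : ℕ => if l < j.val + 1 then extM A i.val l else 0) n,
    ← Finset.sum_filter]
  refine Finset.sum_congr ?_ fun _ _ => rfl
  ext l
  simp
  omega

open Polynomial in
lemma Mmat_coeff {k : Type*} [Field k] {n : ℕ} (A : Matrix (Fin n) (Fin n) k)
    (hA : ∀ i j : Fin n, i < j → A i j = 0) (hA' : ∀ i, A i i ≠ 0) (m : ℕ) (hm : m ≤ n) :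
    (Mmat (extM A) m).charpoly.coeff 0 ≠ 0 := by
  induction m with
  | zero => simp [Matrix.charpoly]
  | succ m ih =>
    rw [Mmat_rec _ (extM_lower A hA), coeff_sub, comb_coeff (fun j => (Mmat (extM A) j).charpoly)]
    have h : m < n := hm
    simp [extM, h, hA', ih h.le]

theorem stmt3 {k : Type*} [Field k] [IsAlgClosed k] {n : ℕ} (hn : 1 ≤ n) :
    Set.BijOn
      (fun A : Matrix (Fin n) (Fin n) k => fun m : Fin n =>
        Matrix.charpoly ((A * Cmat k n).submatrix
          (Fin.castLE m.isLt) (Fin.castLE m.isLt)))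
      {A : Matrix (Fin n) (Fin n) k |
        (∀ i j : Fin n, i < j → A i j = 0) ∧ ∀ i : Fin n, A i i ≠ 0}
      {p : Fin n → Polynomial k | ∀ m : Fin n,
        (p m).Monic ∧ (p m).natDegree = m.val + 1 ∧ (p m).coeff 0 ≠ 0} := by
  have key : ∀ (A : Matrix (Fin n) (Fin n) k) (m : Fin n),
      Matrix.charpoly ((A * Cmat k n).submatrix (Fin.castLE m.isLt) (Fin.castLE m.isLt)) =
        (Mmat (extM A) (m.val + 1)).charpoly := fun A m => by rw [sub_eq_Mmat]
  simp only [key]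
  refine ⟨?_, ?_, ?_⟩
  · rintro A ⟨hA, hA'⟩ m
    refine ⟨Matrix.charpoly_monic _, ?_, Mmat_coeff A hA hA' _ m.isLt⟩
    simp [Matrix.charpoly_natDegree_eq_dim]
  · rintro A ⟨hA, hA'⟩ B ⟨hB, hB'⟩ h
    have hch : ∀ m ≤ n, (Mmat (extM A) m).charpoly = (Mmat (extM B) m).charpoly := by
      intro m hm
      cases m with
      | zero => simp [Matrix.charpoly]
      | succ m => exact congrFun h ⟨m, hm⟩
    ext i j
    rcases lt_or_ge i j with hij | hij
    · rw [hA _ _ hij, hB _ _ hij]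
    · have h1 := hch (i.val + 1) i.isLt
      rw [Mmat_rec _ (extM_lower A hA), Mmat_rec _ (extM_lower B hB), hch i.val i.isLt.le] at h1
      have h2 := sub_right_injective h1
      have h3 := comb_unique (fun j => (Mmat (extM A) j).charpoly) i.val
        (fun j hj => Mmat_coeff A hA hA' j (by omega)) (extM A i) (extM B i)
        (by
          rw [h2]
          refine Finset.sum_congr rfl fun j hj => ?_
          have := Finset.mem_range.1 hj
          rw [hch j (by omega)]) j.val hij
      simpa [extM] using h3
  · intro p hp
    let f : ℕ → Polynomial k := fun j =>
      match j with
      | 0 => 1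
      | j + 1 => if h : j < n then p ⟨j, h⟩ else 1
    have f0 : f 0 = 1 := rfl
    have fs : ∀ j (h : j < n), f (j + 1) = p ⟨j, h⟩ := fun j h => by simp [f, h]
    have fm : ∀ j ≤ n, (f j).Monic ∧ (f j).natDegree = j ∧ (f j).coeff 0 ≠ 0 := by
      intro j hj
      cases j with
      | zero => simp [f0]
      | succ j => rw [fs j hj]; exact hp ⟨j, hj⟩
    have hex : ∀ m : ℕ, ∃ c : ℕ → k, m < n → Polynomial.X * f m - f (m + 1) =
        ∑ j ∈ Finset.range (m + 1),
          Polynomial.C (c j) * Polynomial.X ^ (m - j) * f j := by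
      intro m
      by_cases hm : m < n
      · obtain ⟨a1, a2, a3⟩ := fm m hm.le
        obtain ⟨b1, b2, b3⟩ := fm (m + 1) hm
        have c1 : (Polynomial.X * f m).natDegree = m + 1 := by
          rw [Polynomial.natDegree_X_mul a1.ne_zero, a2]
        have c2 : (Polynomial.X * f m).Monic := Polynomial.monic_X.mul a1
        obtain ⟨c, hc⟩ := comb_exists f m (fun j hj => (fm j (by omega)).2.2)
          (fun j hj => (fm j (by omega)).2.1.le) (Polynomial.X * f m - f (m + 1)) (by
            have hlt : (Polynomial.X * f m - f (m + 1)).degree < (Polynomial.X * f m).degree :=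
              Polynomial.degree_sub_lt
                (by rw [Polynomial.degree_eq_natDegree c2.ne_zero,
                  Polynomial.degree_eq_natDegree b1.ne_zero, c1, b2])
                c2.ne_zero (by rw [c2.leadingCoeff, b1.leadingCoeff])
            rw [Polynomial.degree_eq_natDegree c2.ne_zero, c1] at hlt
            exact Polynomial.natDegree_le_iff_degree_le.2 (by
              by_cases hz : (Polynomial.X * f m - f (m + 1)) = 0
              · simp [hz]
              · rw [Polynomial.degree_eq_natDegree hz] at hlt ⊢
                have := Nat.cast_lt.1 hlt
                exact Nat.cast_le.2 (by omega)))
        exact ⟨c, fun _ => hc⟩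
      · exact ⟨0, fun h => absurd h hm⟩
    choose c hc using hex
    let A : Matrix (Fin n) (Fin n) k := Matrix.of fun i j => if j ≤ i then c i j else 0
    have hA : ∀ i j : Fin n, i < j → A i j = 0 := fun i j hij => by simp [A, hij]
    refine ⟨A, ⟨hA, ?_⟩, ?_⟩
    · intro i h
      have h1 := congrArg (fun p => Polynomial.coeff p 0) (hc i i.isLt)
      simp only [comb_coeff] at h1
      have h2 : c i i = 0 := by simpa [A] using h
      simp only [h2] at h1
      exact (fm (i + 1) i.isLt).2.2 (by simpa using h1)
    · have hch : ∀ m, m ≤ n → (Mmat (extM A) m).charpoly = f m := by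
        intro m
        induction m using Nat.strong_induction_on with
        | _ m ih =>
          intro hm
          cases m with
          | zero => simp [Matrix.charpoly, f0]
          | succ m =>
            have hm' : m < n := hm
            rw [Mmat_rec _ (extM_lower A hA), ih m (by omega) (by omega), sub_eq_iff_eq_add,
              ← sub_eq_iff_eq_add', hc m hm]
            refine Finset.sum_congr rfl fun j hj => ?_
            have hj' := Finset.mem_range.1 hj
            have hjm : j ≤ m := by omega
            have hjn : j < n := by omega
            rw [ih j (by omega) (by omega)]
            simp [extM, A, hm', hjn, hjm]
      funext m
      exact (hch _ m.isLt).trans (fs _ m.isLt)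
end

section
/- Let k be an algebraically closed field, and let n_1 < n_2 < … < n_h = n be a strictly increasing sequence of positive integers. Let 𝒜 be the set of invertible lower triangular n×n matrices A = (a_{i,j}) over k such that for every row index i not belonging to {n_1, …, n_h} one has a_{i,i} = 1 and a_{i,j} = 0 for all j < i (so only the rows with index in {n_1, …, n_h} may have off-diagonal entries or a diagonal entry different from 1). For each s = 1, …, h let D_{n_s} be the principal n_s×n_s submatrix of A·C_n, where C_n is the n×n matrix with entries 1 on and above the diagonal and 0 below. Then the map sending A ∈ 𝒜 to the h-tuple of characteristic polynomials of D_{n_1}, …, D_{n_h} is a bijection from 𝒜 onto the set of h-tuples (p_1, …, p_h) of polynomials in k[t] such that each p_s is monic of degree n_s with nonzero constant term. -/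
open Polynomial in
/-- Recursively defined characteristic polynomials. -/
noncomputable def Qpoly {k : Type*} [Field k] (a : ℕ → ℕ → k) : ℕ → Polynomial k
  | 0 => 1
  | m + 1 => X * Qpoly a m - ∑ j : Fin (m + 1), C (a m j) * X ^ (m - (j : ℕ)) * Qpoly a j
decreasing_by
  all_goals omega

open Polynomial in
theorem Qpoly_succ {k : Type*} [Field k] (a : ℕ → ℕ → k) (m : ℕ) :
    Qpoly a (m + 1) = X * Qpoly a m
      - ∑ j ∈ Finset.range (m + 1), C (a m j) * X ^ (m - j) * Qpoly a j := by
  rw [Qpoly, ← Fin.sum_univ_eq_sum_range (fun j => C (a m j) * X ^ (m - j) * Qpoly a j)]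

theorem Qpoly_zero {k : Type*} [Field k] (a : ℕ → ℕ → k) : Qpoly a 0 = 1 := by
  rw [Qpoly]

theorem Qpoly_congr {k : Type*} [Field k] (a b : ℕ → ℕ → k) (m : ℕ)
    (h : ∀ i < m, ∀ j ≤ i, a i j = b i j) : Qpoly a m = Qpoly b m := by
  induction m using Nat.strong_induction_on with
  | _ m ih =>
    cases m with
    | zero => simp [Qpoly_zero]
    | succ m =>
      rw [Qpoly_succ, Qpoly_succ, ih m (by omega) (fun i hi => h i (by omega))]
      congr 1
      refine Finset.sum_congr rfl fun j hj => ?_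
      rw [Finset.mem_range] at hj
      rw [h m (by omega) j (by omega), ih j hj (fun i hi => h i (by omega))]

open Polynomial in
theorem exists_coeffs {k : Type*} [Field k] (q : ℕ → Polynomial k) (m : ℕ)
    (hdeg : ∀ j ≤ m, (q j).natDegree ≤ j) (h0 : ∀ j ≤ m, (q j).coeff 0 ≠ 0)
    (r : Polynomial k) (hr : r.natDegree ≤ m) :
    ∃ c : ℕ → k, r = ∑ j ∈ Finset.range (m + 1), C (c j) * X ^ (m - j) * q j := by
  induction m generalizing r with
  | zero =>
    refine ⟨fun _ => r.coeff 0 / (q 0).coeff 0, ?_⟩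
    have h1 := eq_C_of_natDegree_le_zero hr
    have h2 := eq_C_of_natDegree_le_zero (hdeg 0 le_rfl)
    have h3 := h0 0 le_rfl
    simp only [zero_add, Finset.range_one, Finset.sum_singleton, Nat.sub_zero, pow_zero, mul_one]
    conv_rhs => rw [h2]
    rw [← C_mul, h1]
    simp [h3]
  | succ m ih =>
    set d := r.coeff 0 / (q (m + 1)).coeff 0 with hd
    have h3 := h0 (m + 1) le_rfl
    set r1 := r - C d * q (m + 1) with hr1
    have hz : r1.coeff 0 = 0 := by
      simp [hr1, hd, h3]
    have hr1d : r1.natDegree ≤ m + 1 := by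
      refine (natDegree_sub_le _ _).trans (max_le hr ?_)
      exact (natDegree_C_mul_le _ _).trans (hdeg _ le_rfl)
    have hX : r1 = X * r1.divX := by
      have := X_mul_divX_add r1
      rw [hz] at this
      simpa using this.symm
    obtain ⟨c, hc⟩ := ih (fun j hj => hdeg j (by omega)) (fun j hj => h0 j (by omega)) r1.divX
      (by rw [natDegree_divX_eq_natDegree_tsub_one]; omega)
    refine ⟨fun j => if j = m + 1 then d else c j, ?_⟩
    rw [Finset.sum_range_succ]
    have : r = r1 + C d * q (m + 1) := by rw [hr1]; ring
    rw [this, hX]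
    simp only [if_true, Nat.sub_self, pow_zero, mul_one]
    congr 1
    conv_lhs => rw [hc, Finset.mul_sum]
    refine Finset.sum_congr rfl fun j hj => ?_
    rw [Finset.mem_range] at hj
    rw [if_neg (by omega), show m + 1 - j = (m - j) + 1 by omega]
    ring

open Polynomial in
theorem coeffs_zero {k : Type*} [Field k] (q : ℕ → Polynomial k) (m : ℕ)
    (h0 : ∀ j ≤ m, (q j).coeff 0 ≠ 0) (c : ℕ → k)
    (hc : ∑ j ∈ Finset.range (m + 1), C (c j) * X ^ (m - j) * q j = 0) :
    ∀ j ≤ m, c j = 0 := by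
  induction m with
  | zero =>
    intro j hj
    obtain rfl : j = 0 := by omega
    have := congrArg (fun p => p.coeff 0) hc
    simpa [h0 0 le_rfl] using this
  | succ m ih =>
    have hX : ∑ j ∈ Finset.range (m + 1), C (c j) * X ^ (m + 1 - j) * q j
        = X * ∑ j ∈ Finset.range (m + 1), C (c j) * X ^ (m - j) * q j := by
      rw [Finset.mul_sum]
      refine Finset.sum_congr rfl fun j hj => ?_
      rw [Finset.mem_range] at hj
      rw [show m + 1 - j = (m - j) + 1 by omega]
      ring
    rw [Finset.sum_range_succ, hX] at hc
    have hm : c (m + 1) = 0 := by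
      have := congrArg (fun p => p.coeff 0) hc
      simpa [h0 (m + 1) le_rfl] using this
    rw [hm] at hc
    have hc' : ∑ j ∈ Finset.range (m + 1), C (c j) * X ^ (m - j) * q j = 0 := by
      simpa using hc
    intro j hj
    rcases Nat.lt_or_ge m j with h | h
    · obtain rfl : j = m + 1 := by omega
      exact hm
    · exact ih (fun j hj => h0 j (by omega)) hc' j h

open Polynomial in
theorem coeff_zero_sum {k : Type*} [Field k] (q : ℕ → Polynomial k) (m : ℕ) (c : ℕ → k) :
    (∑ j ∈ Finset.range (m + 1), C (c j) * X ^ (m - j) * q j).coeff 0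
      = c m * (q m).coeff 0 := by
  rw [Finset.sum_range_succ, coeff_add, finsetSum_coeff, Finset.sum_eq_zero]
  · simp
  · intro j hj
    rw [Finset.mem_range] at hj
    rw [show m - j = (m - j - 1) + 1 by omega]
    simp [mul_coeff_zero]

theorem Qpoly_coeff_zero {k : Type*} [Field k] (a : ℕ → ℕ → k) (m : ℕ)
    (h : ∀ i < m, a i i ≠ 0) : (Qpoly a m).coeff 0 ≠ 0 := by
  induction m with
  | zero => simp [Qpoly_zero]
  | succ m ih =>
    rw [Qpoly_succ, Polynomial.coeff_sub, coeff_zero_sum]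
    simp [h m (by omega), ih (fun i hi => h i (by omega))]

open Polynomial in
/-- The Hessenberg matrix. -/
noncomputable def Hess {k : Type*} [Field k] (a : ℕ → ℕ → k) (m : ℕ) :
    Matrix (Fin m) (Fin m) (Polynomial k) :=
  Matrix.of fun i j => (if i = j then X else 0) - (if (j : ℕ) = i + 1 then X else 0)
    - (if j ≤ i then C (a i j) else 0)

open Polynomial in
theorem Hess_mulVec {k : Type*} [Field k] (a : ℕ → ℕ → k) (m : ℕ) :
    (Hess a (m + 1)).mulVec (fun j => X ^ (m - (j : ℕ)) * Qpoly a j)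
      = Pi.single (Fin.last m) (Qpoly a (m + 1)) := by
  ext1 i
  have hi := i.2
  have h1 : ∀ j : Fin (m + 1), (i = j) ↔ ((i : ℕ) = j) := fun j => Fin.ext_iff
  simp only [Matrix.mulVec, dotProduct, Hess, Matrix.of_apply, sub_mul, Finset.sum_sub_distrib,
    ite_mul, zero_mul, h1, Fin.le_def]
  rw [Fin.sum_univ_eq_sum_range (fun j => if (i : ℕ) = j then X * (X ^ (m - j) * Qpoly a j) else 0),
    Fin.sum_univ_eq_sum_range (fun j => if j = (i : ℕ) + 1 then X * (X ^ (m - j) * Qpoly a j) else 0),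
    Fin.sum_univ_eq_sum_range
      (fun j => if j ≤ (i : ℕ) then C (a i j) * (X ^ (m - j) * Qpoly a j) else 0)]
  have h3 : ∑ j ∈ Finset.range (m + 1),
      (if j ≤ (i : ℕ) then C (a i j) * (X ^ (m - j) * Qpoly a j) else 0)
      = X ^ (m - (i : ℕ)) *
        ∑ j ∈ Finset.range ((i : ℕ) + 1), C (a i j) * X ^ ((i : ℕ) - j) * Qpoly a j := by
    rw [← Finset.sum_filter, Finset.mul_sum]
    have : (Finset.range (m + 1)).filter (fun j => j ≤ (i : ℕ)) = Finset.range ((i : ℕ) + 1) := by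
      ext j
      simp only [Finset.mem_filter, Finset.mem_range]
      omega
    rw [this]
    refine Finset.sum_congr rfl fun j hj => ?_
    rw [Finset.mem_range] at hj
    rw [show m - j = (m - i) + (i - j) by omega, pow_add]
    ring
  have hQ := Qpoly_succ a i
  have hQ' : ∑ j ∈ Finset.range ((i : ℕ) + 1), C (a i j) * X ^ ((i : ℕ) - j) * Qpoly a j
    = X * Qpoly a i - Qpoly a (i + 1) := by rw [hQ]; ring
  rw [h3, hQ', Finset.sum_ite_eq, Finset.sum_ite_eq']
  simp only [Finset.mem_range, hi, if_true]
  by_cases him : (i : ℕ) = m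
  · have : i = Fin.last m := Fin.ext him
    subst this
    simp
  · have : i ≠ Fin.last m := fun h => him (by rw [h]; rfl)
    rw [Pi.single_eq_of_ne this, if_pos (by omega), show m - (i : ℕ) = (m - (i + 1)) + 1 by omega]
    ring

open Polynomial in
theorem Hess_det {k : Type*} [Field k] (a : ℕ → ℕ → k) (m : ℕ) :
    (Hess a m).det = Qpoly a m := by
  cases m with
  | zero => simp [Qpoly_zero]
  | succ m =>
    have h1 : ((Hess a (m + 1)).updateCol 0
        ((Hess a (m + 1)).mulVec (fun j => X ^ (m - (j : ℕ)) * Qpoly a j))).det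
        = X ^ m * (Hess a (m + 1)).det := by
      rw [← Matrix.cramer_apply, Matrix.cramer_eq_adjugate_mulVec, Matrix.mulVec_mulVec,
        Matrix.adjugate_mul, Matrix.smul_mulVec, Matrix.one_mulVec]
      simp [Qpoly_zero, mul_comm]
    rw [Hess_mulVec, Matrix.det_succ_column_zero, Finset.sum_eq_single (Fin.last m)] at h1
    · have h2 : ((((Hess a (m + 1)).updateCol 0
          (Pi.single (Fin.last m) (Qpoly a (m + 1)))).submatrix
            (Fin.last m).succAbove Fin.succ)).det = (-X) ^ m := by
        rw [Matrix.det_of_isLowerTriangular]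
        · rw [Finset.prod_eq_pow_card (b := -X)]
          · simp
          · intro i _
            simp only [Matrix.submatrix_apply, Matrix.updateCol_apply, Hess, Fin.ext_iff,
              Fin.le_def, Matrix.of_apply, Fin.succAbove_last, Fin.val_castSucc, Fin.val_succ]
            rw [if_neg (by simp), if_neg (by omega), if_pos trivial, if_neg (by omega)]
            simp
        · intro i j hij
          have hij' : (i : ℕ) < j := hij
          simp only [Matrix.submatrix_apply, Matrix.updateCol_apply, Hess, Fin.ext_iff, Fin.le_def,
            Matrix.of_apply, Fin.succAbove_last, Fin.val_castSucc, Fin.val_succ]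
          rw [if_neg (by simp), if_neg (by omega), if_neg (by omega), if_neg (by omega)]
          simp
      rw [h2] at h1
      simp only [Matrix.updateCol_self, Pi.single_eq_same, Fin.val_last] at h1
      have h3 : X ^ m * Qpoly a (m + 1) = X ^ m * (Hess a (m + 1)).det := by
        rw [← h1, neg_pow (X : Polynomial k) m]
        have : ((-1 : Polynomial k) ^ m) * (-1) ^ m = 1 := by rw [← mul_pow]; simp
        linear_combination (- X ^ m * Qpoly a (m + 1)) * this
      exact (mul_left_cancel₀ (pow_ne_zero _ X_ne_zero) h3).symm
    · intro b _ hb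
      simp [Pi.single_eq_of_ne hb]
    · simp

theorem Cmat_det {k : Type*} [Field k] (m : ℕ) : (Cmat k m).det = 1 := by
  rw [Matrix.det_of_isUpperTriangular]
  · simp [Cmat]
  · intro i j hij
    have : ¬ i ≤ j := not_le.mpr hij
    simp [Cmat, this]

open Polynomial in
theorem Hess_mul {k : Type*} [Field k] (a : ℕ → ℕ → k) (m : ℕ) :
    Hess a m * (Cmat k m).map C = Matrix.charmatrix
      ((Matrix.of fun i j : Fin m => if j ≤ i then a i j else 0) * Cmat k m) := by
  ext1 i j
  have hi := i.2
  have hj := j.2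
  rw [Matrix.charmatrix_apply, Matrix.mul_apply, Matrix.mul_apply]
  simp only [Hess, Matrix.of_apply, sub_mul, Finset.sum_sub_distrib, map_sum, C_mul,
    Matrix.map_apply]
  congr 1
  · simp only [Cmat, Matrix.of_apply, ite_mul, zero_mul, Fin.le_def, Fin.ext_iff]
    rw [Fin.sum_univ_eq_sum_range (fun x => if (i : ℕ) = x then
        X * C (if x ≤ (j : ℕ) then (1 : k) else 0) else 0),
      Fin.sum_univ_eq_sum_range (fun x => if x = (i : ℕ) + 1 then
        X * C (if x ≤ (j : ℕ) then (1 : k) else 0) else 0), Finset.sum_ite_eq, Finset.sum_ite_eq']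
    simp only [Finset.mem_range, hi, if_true, Matrix.diagonal_apply, Fin.ext_iff]
    split_ifs <;> first | omega | simp
  · refine Finset.sum_congr rfl fun x _ => ?_
    split_ifs <;> simp

open Polynomial in
theorem charpoly_eq {k : Type*} [Field k] (a : ℕ → ℕ → k) (m : ℕ) :
    ((Matrix.of fun i j : Fin m => if j ≤ i then a i j else 0) * Cmat k m).charpoly
      = Qpoly a m := by
  have h : ((Cmat k m).map C).det = 1 := by
    have := (RingHom.map_det (C : k →+* Polynomial k) (Cmat k m)).symm
    rw [Cmat_det, map_one] at this
    exact this
  rw [Matrix.charpoly, ← Hess_mul, Matrix.det_mul, h, mul_one, Hess_det]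

theorem submatrix_eq {k : Type*} [Field k] {n m : ℕ} (hm : m ≤ n) (a : ℕ → ℕ → k)
    (A : Matrix (Fin n) (Fin n) k) (hA : ∀ i j : Fin n, i < j → A i j = 0)
    (ha : ∀ i j : Fin n, j ≤ i → A i j = a i j) :
    (A * Cmat k n).submatrix (Fin.castLE hm) (Fin.castLE hm)
      = (Matrix.of fun i j : Fin m => if j ≤ i then a i j else 0) * Cmat k m := by
  have hA' : A = Matrix.of fun i j : Fin n => if j ≤ i then a i j else 0 := by
    ext i j
    rw [Matrix.of_apply]
    split_ifs with h
    · exact ha i j h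
    · exact hA i j (not_le.mp h)
  ext i j
  have hi := i.2
  rw [hA', Matrix.submatrix_apply, Matrix.mul_apply, Matrix.mul_apply]
  simp only [Cmat, Matrix.of_apply, Fin.le_def, Fin.val_castLE]
  rw [Fin.sum_univ_eq_sum_range (fun x => (if x ≤ (i : ℕ) then a i x else 0) *
      (if x ≤ (j : ℕ) then (1 : k) else 0)),
    Fin.sum_univ_eq_sum_range (fun x => (if x ≤ (i : ℕ) then a i x else 0) *
      (if x ≤ (j : ℕ) then (1 : k) else 0))]
  symm
  apply Finset.sum_subset
  · intro x; simp only [Finset.mem_range]; omega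
  · intro x _ hx
    rw [Finset.mem_range] at hx
    rw [if_neg (by omega), zero_mul]

theorem charpoly_sub {k : Type*} [Field k] {n m : ℕ} (hm : m ≤ n) (a : ℕ → ℕ → k)
    (A : Matrix (Fin n) (Fin n) k) (hA : ∀ i j : Fin n, i < j → A i j = 0)
    (ha : ∀ i j : Fin n, j ≤ i → A i j = a i j) :
    ((A * Cmat k n).submatrix (Fin.castLE hm) (Fin.castLE hm)).charpoly = Qpoly a m := by
  rw [submatrix_eq hm a A hA ha, charpoly_eq]

/-- Extension of a matrix by zero. -/
def extMat {k : Type*} [Field k] {n : ℕ} (A : Matrix (Fin n) (Fin n) k) : ℕ → ℕ → k :=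
  fun i j => if h : i < n ∧ j < n then A ⟨i, h.1⟩ ⟨j, h.2⟩ else 0

theorem extMat_apply {k : Type*} [Field k] {n : ℕ} (A : Matrix (Fin n) (Fin n) k)
    (i j : Fin n) : extMat A i j = A i j := by
  simp [extMat]

open Polynomial in
/-- The target sequence of polynomials. -/
noncomputable def Pseq {k : Type*} [Field k] {h : ℕ} (ns : Fin h → ℕ)
    (p : Fin h → Polynomial k) : ℕ → Polynomial k
  | 0 => 1
  | m + 1 => open Classical in
      if hs : ∃ s, ns s = m + 1 then p hs.choose else (X - C 1) * Pseq ns p m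

open Polynomial in
theorem Pseq_prop {k : Type*} [Field k] {h : ℕ} (ns : Fin h → ℕ)
    (p : Fin h → Polynomial k)
    (hp : ∀ s : Fin h, (p s).Monic ∧ (p s).natDegree = ns s ∧ (p s).coeff 0 ≠ 0) (m : ℕ) :
    (Pseq ns p m).Monic ∧ (Pseq ns p m).natDegree = m ∧ (Pseq ns p m).coeff 0 ≠ 0 := by
  induction m with
  | zero => simp [Pseq]
  | succ m ih =>
    rw [Pseq]
    split_ifs with hs
    · have := hp hs.choose
      rw [hs.choose_spec] at this
      exact this
    · refine ⟨(monic_X_sub_C 1).mul ih.1, ?_, ?_⟩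
      · rw [(monic_X_sub_C (1 : k)).natDegree_mul ih.1, natDegree_X_sub_C, ih.2.1]; omega
      · rw [mul_coeff_zero]
        simp [ih.2.2]

open Polynomial in
theorem Pseq_step {k : Type*} [Field k] {h : ℕ} (ns : Fin h → ℕ)
    (p : Fin h → Polynomial k)
    (hp : ∀ s : Fin h, (p s).Monic ∧ (p s).natDegree = ns s ∧ (p s).coeff 0 ≠ 0) (m : ℕ) :
    ∃ c : ℕ → k, (X * Pseq ns p m - Pseq ns p (m + 1)
        = ∑ j ∈ Finset.range (m + 1), C (c j) * X ^ (m - j) * Pseq ns p j) ∧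
      ((¬ ∃ s, ns s = m + 1) → c = Pi.single m 1) := by
  by_cases hs : ∃ s, ns s = m + 1
  · have h1 := Pseq_prop ns p hp m
    have h2 := Pseq_prop ns p hp (m + 1)
    obtain ⟨c, hc⟩ := exists_coeffs (Pseq ns p) m (fun j _ => (Pseq_prop ns p hp j).2.1.le)
      (fun j _ => (Pseq_prop ns p hp j).2.2) (X * Pseq ns p m - Pseq ns p (m + 1)) (by
        have hd : (X * Pseq ns p m).natDegree = m + 1 := by
          rw [monic_X.natDegree_mul h1.1, natDegree_X, h1.2.1]; omega
        have hlt : (X * Pseq ns p m - Pseq ns p (m + 1)).degree < (X * Pseq ns p m).degree := by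
          apply degree_sub_lt_left
          · rw [degree_eq_natDegree (monic_X.mul h1.1).ne_zero, degree_eq_natDegree h2.1.ne_zero,
              hd, h2.2.1]
          · exact (monic_X.mul h1.1).ne_zero
          · rw [(monic_X.mul h1.1).leadingCoeff, h2.1.leadingCoeff]
        rw [degree_eq_natDegree (monic_X.mul h1.1).ne_zero, hd] at hlt
        by_cases hz : X * Pseq ns p m - Pseq ns p (m + 1) = 0
        · rw [hz]; simp
        · exact Nat.le_of_lt_succ ((natDegree_lt_iff_degree_lt hz).mpr hlt))
    exact ⟨c, hc, fun h => absurd hs h⟩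
  · refine ⟨Pi.single m 1, ?_, fun _ => rfl⟩
    rw [Finset.sum_eq_single m]
    · conv_lhs => rw [Pseq, dif_neg hs]
      simp
      ring
    · intro j _ hj
      simp [Pi.single_eq_of_ne hj]
    · simp

theorem stmt4 {k : Type*} [Field k] [IsAlgClosed k] {n h : ℕ} (hh : 0 < h)
    (ns : Fin h → ℕ) (hmono : StrictMono ns) (hpos : ∀ s, 0 < ns s)
    (hlast : ns ⟨h - 1, Nat.sub_lt hh Nat.one_pos⟩ = n)
    (hle : ∀ s, ns s ≤ n) :
    Set.BijOn
      (fun A : Matrix (Fin n) (Fin n) k => fun s : Fin h =>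
        Matrix.charpoly ((A * Cmat k n).submatrix
          (Fin.castLE (hle s)) (Fin.castLE (hle s))))
      {A : Matrix (Fin n) (Fin n) k |
        (∀ i j : Fin n, i < j → A i j = 0) ∧ (∀ i : Fin n, A i i ≠ 0) ∧
        ∀ i : Fin n, (¬ ∃ s : Fin h, ns s = i.val + 1) →
          A i i = 1 ∧ ∀ j : Fin n, j < i → A i j = 0}
      {p : Fin h → Polynomial k | ∀ s : Fin h,
        (p s).Monic ∧ (p s).natDegree = ns s ∧ (p s).coeff 0 ≠ 0} := by
  refine ⟨?_, ?_, ?_⟩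
  · rintro A ⟨hA, hd, -⟩ s
    refine ⟨Matrix.charpoly_monic _, ?_, ?_⟩
    · simp
    · show (Matrix.charpoly _).coeff 0 ≠ 0
      rw [charpoly_sub (hle s) (extMat A) A hA (fun i j _ => (extMat_apply A i j).symm)]
      apply Qpoly_coeff_zero
      intro i hi
      have := extMat_apply A ⟨i, hi.trans_le (hle s)⟩ ⟨i, hi.trans_le (hle s)⟩
      rw [this]
      exact hd _
  · rintro A ⟨hA, hAd, hA1⟩ B ⟨hB, hBd, hB1⟩ hAB
    have hQ : ∀ s, Qpoly (extMat A) (ns s) = Qpoly (extMat B) (ns s) := by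
      intro s
      rw [← charpoly_sub (hle s) (extMat A) A hA (fun i j _ => (extMat_apply A i j).symm),
        ← charpoly_sub (hle s) (extMat B) B hB (fun i j _ => (extMat_apply B i j).symm)]
      exact congrFun hAB s
    have key : ∀ i, i < n → ∀ j ≤ i, extMat A i j = extMat B i j := by
      intro i
      induction i using Nat.strong_induction_on with
      | _ i ih =>
        intro hi
        by_cases hs : ∃ s, ns s = i + 1
        · obtain ⟨s, hs⟩ := hs
          have hq := hQ s
          have hQj : ∀ j ≤ i, Qpoly (extMat A) j = Qpoly (extMat B) j := fun j hj =>
            Qpoly_congr _ _ _ fun i' hi' => ih i' (by omega) (by omega)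
          rw [hs, Qpoly_succ, Qpoly_succ, hQj i le_rfl] at hq
          have hq' := sub_right_injective hq
          have hz := coeffs_zero (Qpoly (extMat A)) i
            (fun j hj => Qpoly_coeff_zero _ _ (fun l hl => by
              have := extMat_apply A ⟨l, by omega⟩ ⟨l, by omega⟩
              rw [this]
              exact hAd _))
            (fun j => extMat A i j - extMat B i j) (by
              simp only [Polynomial.C_sub, sub_mul, Finset.sum_sub_distrib]
              rw [hq', sub_eq_zero]
              refine Finset.sum_congr rfl fun j hj => ?_
              rw [Finset.mem_range] at hj
              rw [hQj j (by omega)])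
          intro j hj
          exact sub_eq_zero.mp (hz j hj)
        · intro j hj
          have ha := extMat_apply A ⟨i, hi⟩ ⟨j, by omega⟩
          have hb := extMat_apply B ⟨i, hi⟩ ⟨j, by omega⟩
          have h1 := hA1 ⟨i, hi⟩ hs
          have h2 := hB1 ⟨i, hi⟩ hs
          simp only at ha hb
          rw [ha, hb]
          rcases hj.lt_or_eq with hlt | rfl
          · rw [h1.2 _ hlt, h2.2 _ hlt]
          · rw [h1.1, h2.1]
    ext i j
    rcases lt_or_ge i j with hij | hij
    · rw [hA i j hij, hB i j hij]
    · rw [← extMat_apply A, ← extMat_apply B]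
      exact key i i.2 j hij
  · intro p hp
    choose a ha ha1 using Pseq_step ns p hp
    have hQP : ∀ m, Qpoly a m = Pseq ns p m := by
      intro m
      induction m using Nat.strong_induction_on with
      | _ m ih =>
        cases m with
        | zero => rw [Qpoly_zero, Pseq]
        | succ m =>
          have hsum : ∑ j ∈ Finset.range (m + 1),
              Polynomial.C (a m j) * Polynomial.X ^ (m - j) * Qpoly a j
              = ∑ j ∈ Finset.range (m + 1),
              Polynomial.C (a m j) * Polynomial.X ^ (m - j) * Pseq ns p j := by
            refine Finset.sum_congr rfl fun j hj => ?_
            rw [Finset.mem_range] at hj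
            rw [ih j hj]
          rw [Qpoly_succ, hsum, ← ha m, ih m (by omega)]
          ring
    have hdiag : ∀ m, a m m ≠ 0 := by
      intro m hm
      have h1 := congrArg (fun q => Polynomial.coeff q 0) (ha m)
      rw [coeff_zero_sum, hm] at h1
      have h2 := (Pseq_prop ns p hp (m + 1)).2.2
      simp at h1
      exact h2 h1
    refine ⟨Matrix.of fun i j : Fin n => if j ≤ i then a i j else 0, ⟨?_, ?_, ?_⟩, ?_⟩
    · intro i j hij
      simp [not_le.mpr hij]
    · intro i
      simpa using hdiag i
    · intro i hi
      have h1 := ha1 i hi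
      refine ⟨by simp [h1], fun j hj => ?_⟩
      have hne : (j : ℕ) ≠ i := fun h => hj.ne (Fin.ext h)
      simp [h1, Pi.single_eq_of_ne hne]
    · funext s
      show Matrix.charpoly _ = _
      rw [charpoly_sub (hle s) a _ (fun i j hij => by simp [not_le.mpr hij])
        (fun i j hij => by simp [hij]), hQP]
      obtain ⟨m, hm⟩ : ∃ m, ns s = m + 1 := ⟨ns s - 1, by have := hpos s; omega⟩
      have hs : ∃ s, ns s = m + 1 := ⟨s, hm⟩
      rw [hm, Pseq, dif_pos hs]
      congr 1
      exact hmono.injective (hs.choose_spec.trans hm.symm)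
end
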